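/- Hölder-type bound for the auxiliary trilinear form b0. Let ψ, χ, ξ : ℝ² → ℝ be smooth functions such that χ and ξ have compact support and the gradient of ψ is bounded, with sup_{p∈ℝ²} (ψ_x(p)² + ψ_y(p)²)^{1/2} ≤ M. Then |b0(ψ;χ,ξ)| ≤ 4·M·‖D²χ‖_{L²}·‖∇ξ‖_{L²}, where b0(ψ;χ,ξ) = ∫_{ℝ²} [(ψ_y·χ_xy − ψ_x·χ_yy)·ξ_y − (ψ_x·χ_xy − ψ_y·χ_xx)·ξ_x]. (Combined with the finite element inverse inequality ‖∇ψ‖_{L∞} ≤ c·√|ln h|·‖D²ψ‖_{L²}, this yields the bound |b0(ψ;χ,ξ)| ≤ C·√|ln h|·|ψ|₂·|ξ|₁·|χ|₂ of the paper.) -/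

import Mathlib

open MeasureTheory

/-- Partial derivative in the first coordinate direction. -/
noncomputable def pdx (f : ℝ × ℝ → ℝ) (p : ℝ × ℝ) : ℝ := fderiv ℝ f p (1, 0)

/-- Partial derivative in the second coordinate direction. -/
noncomputable def pdy (f : ℝ × ℝ → ℝ) (p : ℝ × ℝ) : ℝ := fderiv ℝ f p (0, 1)

/-- Laplacian Δf = f_xx + f_yy. -/
noncomputable def lap (f : ℝ × ℝ → ℝ) (p : ℝ × ℝ) : ℝ := pdx (pdx f) p + pdy (pdy f) p

/-- Squared Frobenius norm of the Hessian: f_xx² + 2 f_xy² + f_yy². -/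
noncomputable def hessSq (f : ℝ × ℝ → ℝ) (p : ℝ × ℝ) : ℝ :=
  pdx (pdx f) p ^ 2 + 2 * pdx (pdy f) p ^ 2 + pdy (pdy f) p ^ 2

/-- H² seminorm: ‖D²f‖_{L²}. -/
noncomputable def seminormH2 (f : ℝ × ℝ → ℝ) : ℝ := Real.sqrt (∫ p, hessSq f p)

/-- H¹ seminorm: ‖∇f‖_{L²}. -/
noncomputable def seminormH1 (f : ℝ × ℝ → ℝ) : ℝ :=
  Real.sqrt (∫ p, (pdx f p ^ 2 + pdy f p ^ 2))

/-- L² norm. -/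
noncomputable def normL2 (g : ℝ × ℝ → ℝ) : ℝ := Real.sqrt (∫ p, g p ^ 2)

/-- Auxiliary trilinear form b0(ψ;χ,ξ). -/
noncomputable def b0 (ψ χ ξ : ℝ × ℝ → ℝ) : ℝ :=
  ∫ p, ((pdy ψ p * pdx (pdy χ) p - pdx ψ p * pdy (pdy χ) p) * pdy ξ p -
        (pdx ψ p * pdx (pdy χ) p - pdy ψ p * pdx (pdx χ) p) * pdx ξ p)

lemma contDiff_pdx {f : ℝ × ℝ → ℝ} (hf : ContDiff ℝ (⊤ : ℕ∞) f) :
    ContDiff ℝ (⊤ : ℕ∞) (pdx f) :=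
  (hf.fderiv_right (m := (⊤ : ℕ∞)) (by simp)).clm_apply contDiff_const

lemma contDiff_pdy {f : ℝ × ℝ → ℝ} (hf : ContDiff ℝ (⊤ : ℕ∞) f) :
    ContDiff ℝ (⊤ : ℕ∞) (pdy f) :=
  (hf.fderiv_right (m := (⊤ : ℕ∞)) (by simp)).clm_apply contDiff_const

lemma hasCompactSupport_pdx {f : ℝ × ℝ → ℝ} (hf : HasCompactSupport f) :
    HasCompactSupport (pdx f) := hf.fderiv_apply ℝ (1, 0)

lemma hasCompactSupport_pdy {f : ℝ × ℝ → ℝ} (hf : HasCompactSupport f) :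
    HasCompactSupport (pdy f) := hf.fderiv_apply ℝ (0, 1)

/-- Pointwise bound for the integrand of `b0`. -/
lemma abs_b0_integrand_le {a b r s t u v M : ℝ} (hM : √(a ^ 2 + b ^ 2) ≤ M) :
    |(b * s - a * t) * v - (a * s - b * r) * u| ≤
      M * (√(r ^ 2 + 2 * s ^ 2 + t ^ 2) * √(u ^ 2 + v ^ 2)) := by
  refine le_trans ?_ (mul_le_mul_of_nonneg_right hM (by positivity))
  rw [← Real.sqrt_mul (by positivity), ← Real.sqrt_mul (by positivity)]
  apply Real.abs_le_sqrt
  have h1 : (b * s - a * t) ^ 2 ≤ (a ^ 2 + b ^ 2) * (s ^ 2 + t ^ 2) := by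
    nlinarith [sq_nonneg (b * t + a * s)]
  have h2 : (a * s - b * r) ^ 2 ≤ (a ^ 2 + b ^ 2) * (s ^ 2 + r ^ 2) := by
    nlinarith [sq_nonneg (a * r + b * s)]
  calc ((b * s - a * t) * v - (a * s - b * r) * u) ^ 2
      ≤ ((b * s - a * t) ^ 2 + (a * s - b * r) ^ 2) * (u ^ 2 + v ^ 2) := by
        nlinarith [sq_nonneg ((b * s - a * t) * u + (a * s - b * r) * v)]
    _ ≤ ((a ^ 2 + b ^ 2) * (r ^ 2 + 2 * s ^ 2 + t ^ 2)) * (u ^ 2 + v ^ 2) := by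
        gcongr
        linarith
    _ = _ := by ring

/-- Cauchy–Schwarz for square roots of nonnegative compactly supported continuous functions. -/
lemma integral_sqrt_mul_sqrt_le {H G : ℝ × ℝ → ℝ} (hH : Continuous H) (hG : Continuous G)
    (hHc : HasCompactSupport H) (hGc : HasCompactSupport G) (hH0 : ∀ p, 0 ≤ H p)
    (hG0 : ∀ p, 0 ≤ G p) :
    ∫ p, √(H p) * √(G p) ≤ √(∫ p, H p) * √(∫ p, G p) := by
  have h := integral_mul_le_Lp_mul_Lq_of_nonneg (μ := (volume : Measure (ℝ × ℝ)))
    Real.HolderConjugate.two_two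
    (f := fun p => √(H p)) (g := fun p => √(G p))
    (ae_of_all _ fun p => Real.sqrt_nonneg _) (ae_of_all _ fun p => Real.sqrt_nonneg _)
    (hH.sqrt.memLp_of_hasCompactSupport (hHc.comp_left Real.sqrt_zero))
    (hG.sqrt.memLp_of_hasCompactSupport (hGc.comp_left Real.sqrt_zero))
  simpa only [Real.rpow_two, Real.sq_sqrt (hH0 _), Real.sq_sqrt (hG0 _),
    ← Real.sqrt_eq_rpow] using h

/-- Hölder-type bound for the auxiliary trilinear form b0. -/
theorem b0_holder_bound (ψ χ ξ : ℝ × ℝ → ℝ)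
    (hψ : ContDiff ℝ (⊤ : ℕ∞) ψ) (hχ : ContDiff ℝ (⊤ : ℕ∞) χ) (hξ : ContDiff ℝ (⊤ : ℕ∞) ξ)
    (hχc : HasCompactSupport χ) (hξc : HasCompactSupport ξ)
    (M : ℝ) (hgrad : ∀ p : ℝ × ℝ, Real.sqrt (pdx ψ p ^ 2 + pdy ψ p ^ 2) ≤ M) :
    |b0 ψ χ ξ| ≤ 4 * M * seminormH2 χ * seminormH1 ξ := by
  have hM : 0 ≤ M := (Real.sqrt_nonneg _).trans (hgrad 0)
  have hHcont : Continuous (hessSq χ) :=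
    (((contDiff_pdx (contDiff_pdx hχ)).continuous.pow 2).add
      (((contDiff_pdx (contDiff_pdy hχ)).continuous.pow 2).const_mul 2)).add
      ((contDiff_pdy (contDiff_pdy hχ)).continuous.pow 2)
  have hGcont : Continuous fun p => pdx ξ p ^ 2 + pdy ξ p ^ 2 :=
    ((contDiff_pdx hξ).continuous.pow 2).add ((contDiff_pdy hξ).continuous.pow 2)
  have sq_supp : ∀ {f : ℝ × ℝ → ℝ}, HasCompactSupport f →
      HasCompactSupport fun p => f p ^ 2 := fun hf =>
    hf.comp_left (g := fun x : ℝ => x ^ 2) (by simp)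
  have hHc : HasCompactSupport (hessSq χ) :=
    ((sq_supp (hasCompactSupport_pdx (hasCompactSupport_pdx hχc))).add
      ((sq_supp (hasCompactSupport_pdx (hasCompactSupport_pdy hχc))).mul_left
        (f := fun _ => (2 : ℝ)))).add
      (sq_supp (hasCompactSupport_pdy (hasCompactSupport_pdy hχc)))
  have hGc : HasCompactSupport fun p => pdx ξ p ^ 2 + pdy ξ p ^ 2 :=
    (sq_supp (hasCompactSupport_pdx hξc)).add (sq_supp (hasCompactSupport_pdy hξc))
  have hint : Integrable fun p => √(hessSq χ p) * √(pdx ξ p ^ 2 + pdy ξ p ^ 2) :=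
    (hHcont.sqrt.mul hGcont.sqrt).integrable_of_hasCompactSupport
      ((hGc.comp_left Real.sqrt_zero).mul_left)
  have hbound : |b0 ψ χ ξ| ≤ M * (seminormH2 χ * seminormH1 ξ) := by
    calc |b0 ψ χ ξ|
        ≤ ∫ p, M * (√(hessSq χ p) * √(pdx ξ p ^ 2 + pdy ξ p ^ 2)) := by
          rw [b0, ← Real.norm_eq_abs]
          exact norm_integral_le_of_norm_le (hint.const_mul M)
            (ae_of_all _ fun p => abs_b0_integrand_le (hgrad p))
      _ = M * ∫ p, √(hessSq χ p) * √(pdx ξ p ^ 2 + pdy ξ p ^ 2) := integral_const_mul _ _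
      _ ≤ M * (seminormH2 χ * seminormH1 ξ) :=
          mul_le_mul_of_nonneg_left
            (integral_sqrt_mul_sqrt_le hHcont hGcont hHc hGc
              (fun p => by unfold hessSq; positivity) (fun p => by positivity)) hM
  have hnonneg : 0 ≤ M * (seminormH2 χ * seminormH1 ξ) :=
    mul_nonneg hM (mul_nonneg (Real.sqrt_nonneg _) (Real.sqrt_nonneg _))
  linarith
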